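/- For every n ≥ 0 and every real number x, the binomial convolution of derangement polynomials is γ-positive; more precisely: Σ_{i=0}^{n} C(n,i) d_i(x) d_{n−i}(x) = Σ_{σ ∈ SS_n, fix(σ)=0} (2x)^{exc(σ)} (1+x)^{n − 2·exc(σ)}. -/

import Mathlib

open Finset

namespace SucEuler

/-- One-line notation word of a permutation: `word π i` is the value (in `1..n`)
at position `i ∈ {1,…,n}`, and `0` for positions outside `{1,…,n}`
(this implements the conventions `π(0)=π(n+1)=0`). -/
def word {n : ℕ} (π : Equiv.Perm (Fin n)) (i : ℕ) : ℕ :=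
  if h : 1 ≤ i ∧ i ≤ n then ((π ⟨i - 1, by omega⟩ : Fin n) : ℕ) + 1 else 0

/-- number of descents -/
def des {n : ℕ} (π : Equiv.Perm (Fin n)) : ℕ :=
  ((Finset.Icc 1 (n - 1)).filter fun i => word π (i + 1) < word π i).card

/-- number of ascents -/
def asc {n : ℕ} (π : Equiv.Perm (Fin n)) : ℕ :=
  ((Finset.Icc 1 (n - 1)).filter fun i => word π i < word π (i + 1)).card

/-- number of successions -/
def suc {n : ℕ} (π : Equiv.Perm (Fin n)) : ℕ :=
  ((Finset.Icc 1 (n - 1)).filter fun i => word π (i + 1) = word π i + 1).card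

/-- number of big ascents -/
def basc {n : ℕ} (π : Equiv.Perm (Fin n)) : ℕ :=
  ((Finset.Icc 1 (n - 1)).filter fun i => word π i + 2 ≤ word π (i + 1)).card

/-- number of excedances -/
def excStat {n : ℕ} (σ : Equiv.Perm (Fin n)) : ℕ :=
  (Finset.univ.filter fun i : Fin n => i < σ i).card

/-- number of fixed points -/
def fixStat {n : ℕ} (σ : Equiv.Perm (Fin n)) : ℕ :=
  (Finset.univ.filter fun i : Fin n => σ i = i).card

/-- number of drops -/
def dropStat {n : ℕ} (σ : Equiv.Perm (Fin n)) : ℕ :=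
  (Finset.univ.filter fun i : Fin n => σ i < i).card

/-- number of excedances at positions `i ≥ 2` -/
def excHat {n : ℕ} (σ : Equiv.Perm (Fin n)) : ℕ :=
  (Finset.univ.filter fun i : Fin n => 0 < (i : ℕ) ∧ i < σ i).card

/-- number of fixed points other than `1` -/
def fixHat {n : ℕ} (σ : Equiv.Perm (Fin n)) : ℕ :=
  (Finset.univ.filter fun i : Fin n => 0 < (i : ℕ) ∧ σ i = i).card

/-- number of cycles (orbits) of a permutation -/
def cyc {n : ℕ} (σ : Equiv.Perm (Fin n)) : ℕ :=
  σ.cycleType.card + fixStat σ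

/-- number of cycle double ascents: values `x` with `σ⁻¹(x) < x < σ(x)` -/
def cda {n : ℕ} (σ : Equiv.Perm (Fin n)) : ℕ :=
  (Finset.univ.filter fun x : Fin n => σ⁻¹ x < x ∧ x < σ x).card

open Classical in
/-- number of left-to-right minima -/
noncomputable def lrmin {n : ℕ} (π : Equiv.Perm (Fin n)) : ℕ :=
  ((Finset.Icc 1 n).filter fun i => ∀ j ∈ Finset.Icc 1 n, j < i → word π i < word π j).card

open Classical in
/-- number of proper left-to-right minima -/
noncomputable def plrmin {n : ℕ} (π : Equiv.Perm (Fin n)) : ℕ :=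
  ((Finset.Icc 1 n).filter fun i =>
    (∀ j ∈ Finset.Icc 1 n, j < i → word π i < word π j) ∧ word π i ≠ 1 ∧
      ∃ k ∈ Finset.Icc 1 n, i < k ∧ word π k = word π i - 1 ∧ word π (k + 1) < word π k).card

open Classical in
/-- number of simsun successions -/
noncomputable def simsuc {n : ℕ} (π : Equiv.Perm (Fin n)) : ℕ :=
  ((Finset.Icc 1 n).filter fun i =>
    ∃ j ∈ Finset.Icc 1 n, i < j ∧ word π j = word π i + 1 ∧
      ∀ k ∈ Finset.Icc 1 n, i < k → k < j → word π i + 1 < word π k).card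

/-- number of peaks (with the boundary conventions `π(0)=π(n+1)=0`) -/
def pk {n : ℕ} (π : Equiv.Perm (Fin n)) : ℕ :=
  ((Finset.Icc 1 n).filter fun i => word π (i - 1) < word π i ∧ word π (i + 1) < word π i).card

/-- number of valleys -/
def valStat {n : ℕ} (π : Equiv.Perm (Fin n)) : ℕ :=
  ((Finset.Icc 1 n).filter fun i => word π i < word π (i - 1) ∧ word π i < word π (i + 1)).card

/-- number of double ascents -/
def dasc {n : ℕ} (π : Equiv.Perm (Fin n)) : ℕ :=
  ((Finset.Icc 1 n).filter fun i => word π (i - 1) < word π i ∧ word π i < word π (i + 1)).card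

/-- number of double descents -/
def ddes {n : ℕ} (π : Equiv.Perm (Fin n)) : ℕ :=
  ((Finset.Icc 1 n).filter fun i => word π (i + 1) < word π i ∧ word π i < word π (i - 1)).card

open Classical in
/-- `nextVal σ m x` is the (0-indexed) first value `≤ m` (i.e. `< m` in 0-indexed terms)
in the forward orbit of `x` under `σ`: it equals `σ^t(x)` for the minimal `t ≥ 1`
with `σ^t(x) < m`, when such `t` exists. This is the action of the permutation `σ_k`
(with `m = n - k`) obtained by removing the `k` largest letters from the cycles of `σ`. -/
noncomputable def nextVal {n : ℕ} (σ : Equiv.Perm (Fin n)) (m : ℕ) (x : Fin n) : ℕ :=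
  if h : ∃ t : ℕ, 0 < t ∧ (((σ ^ t) x : Fin n) : ℕ) < m then (((σ ^ Nat.find h) x : Fin n) : ℕ)
  else 0

/-- `σ` is a simsun permutation of the second kind: for every `0 ≤ k ≤ n-1`, the
permutation of `[n-k]` obtained from `σ` by removing the `k` largest letters has
no cycle double ascents. (Here `m = n - k` and values are 0-indexed.) -/
def IsSimsun2 {n : ℕ} (σ : Equiv.Perm (Fin n)) : Prop :=
  ∀ m ≤ n, ∀ x : Fin n, (x : ℕ) < m →
    ¬ (nextVal σ⁻¹ m x < (x : ℕ) ∧ (x : ℕ) < nextVal σ m x)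

noncomputable instance {n : ℕ} : DecidablePred (IsSimsun2 (n := n)) :=
  fun _ => Classical.propDecidable _

/-- the derangement polynomial `d_n(x)` -/
def dpoly (n : ℕ) (x : ℝ) : ℝ :=
  ∑ σ ∈ Finset.univ.filter fun σ : Equiv.Perm (Fin n) => fixStat σ = 0, x ^ excStat σ

/-- the Eulerian polynomial `A_n(x)` -/
def eulerian (n : ℕ) (x : ℝ) : ℝ :=
  ∑ π : Equiv.Perm (Fin n), x ^ des π


/-! ### insertion of the largest letter -/

theorem der_prod {R ι : Type*} [CommRing R] [DecidableEq ι] (D : Derivation ℤ R R)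
    (s : Finset ι) (f : ι → R) :
    D (∏ i ∈ s, f i) = ∑ i ∈ s, (∏ j ∈ s.erase i, f j) * D (f i) := by
  induction s using Finset.induction_on with
  | empty => simp
  | insert a s ha ih =>
    rw [Finset.prod_insert ha, D.leibniz, ih, Finset.sum_insert ha, Finset.erase_insert ha]
    simp only [smul_eq_mul]
    rw [Finset.mul_sum, add_comm, mul_comm]
    refine congrArg₂ _ (by ring) (Finset.sum_congr rfl fun i hi => ?_)
    have hne : a ≠ i := fun h => ha (h ▸ hi)
    rw [Finset.erase_insert_of_ne hne, Finset.prod_insert (fun h => ha (Finset.mem_of_mem_erase h))]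
    ring

/-- insertion equivalence -/
def ins (n : ℕ) : Option (Fin n) × Equiv.Perm (Fin n) ≃ Equiv.Perm (Fin (n + 1)) :=
  Equiv.Perm.decomposeOption.symm.trans finSuccEquivLast.symm.permCongr

theorem ins_none_cs {n : ℕ} (σ : Equiv.Perm (Fin n)) (x : Fin n) :
    ins n (none, σ) x.castSucc = (σ x).castSucc := by
  simp [ins, Equiv.permCongr_apply]

theorem ins_none_last {n : ℕ} (σ : Equiv.Perm (Fin n)) :
    ins n (none, σ) (Fin.last n) = Fin.last n := by
  simp [ins, Equiv.permCongr_apply]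

theorem ins_some_cs {n : ℕ} (σ : Equiv.Perm (Fin n)) (i x : Fin n) :
    ins n (some (σ i), σ) x.castSucc = if x = i then Fin.last n else (σ x).castSucc := by
  by_cases h : x = i
  · subst h
    simp [ins, Equiv.permCongr_apply]
  · have h1 : (some (σ x)) ≠ some (σ i) := by simpa using h
    simp [ins, Equiv.permCongr_apply, h, Equiv.swap_apply_of_ne_of_ne (Option.some_ne_none _) h1]

theorem ins_some_last {n : ℕ} (σ : Equiv.Perm (Fin n)) (i : Fin n) :
    ins n (some (σ i), σ) (Fin.last n) = (σ i).castSucc := by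
  simp [ins, Equiv.permCongr_apply]

theorem ins_none_inv_cs {n : ℕ} (σ : Equiv.Perm (Fin n)) (x : Fin n) :
    (ins n (none, σ))⁻¹ x.castSucc = (σ⁻¹ x).castSucc := by
  rw [Equiv.Perm.inv_eq_iff_eq, ins_none_cs]; simp

theorem ins_some_inv_cs {n : ℕ} (σ : Equiv.Perm (Fin n)) (i x : Fin n) :
    (ins n (some (σ i), σ))⁻¹ x.castSucc =
      if x = σ i then Fin.last n else (σ⁻¹ x).castSucc := by
  rw [Equiv.Perm.inv_eq_iff_eq]
  split_ifs with h
  · rw [ins_some_last, h]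
  · rw [ins_some_cs, if_neg]
    · simp
    · rintro rfl; simp at h

theorem ins_some_inv_last {n : ℕ} (σ : Equiv.Perm (Fin n)) (i : Fin n) :
    (ins n (some (σ i), σ))⁻¹ (Fin.last n) = i.castSucc := by
  rw [Equiv.Perm.inv_eq_iff_eq, ins_some_cs, if_pos rfl]

theorem sum_ins {M : Type*} [AddCommMonoid M] {n : ℕ} (F : Equiv.Perm (Fin (n + 1)) → M) :
    ∑ τ, F τ = ∑ σ : Equiv.Perm (Fin n),
      (F (ins n (none, σ)) + ∑ i, F (ins n (some (σ i), σ))) := by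
  rw [← Equiv.sum_comp (ins n), Fintype.sum_prod_type_right]
  refine Finset.sum_congr rfl fun σ _ => ?_
  rw [Fintype.sum_option]
  congr 1
  exact (Equiv.sum_comp σ (fun j => F (ins n (some j, σ)))).symm

/-! ### all permutations -/

section weights
variable {R : Type*} [CommRing R]

/-- node weight for plain permutations -/
def pw (a b q : R) {n : ℕ} (σ : Equiv.Perm (Fin n)) (i : Fin n) : R :=
  if i < σ i then a else if σ i = i then q else b

/-- total weight -/
def PP (a b q : R) (n : ℕ) : R := ∑ σ : Equiv.Perm (Fin n), ∏ i, pw a b q σ i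

theorem PP_succ (D : Derivation ℤ R R) (a b q : R) (ha : D a = a * b) (hb : D b = a * b)
    (hq : D q = a * b) (n : ℕ) : PP a b q (n + 1) = q * PP a b q n + D (PP a b q n) := by
  unfold PP
  rw [sum_ins, map_sum, Finset.mul_sum, ← Finset.sum_add_distrib]
  refine Finset.sum_congr rfl fun σ _ => ?_
  rw [der_prod]
  congr 1
  · rw [Fin.prod_univ_castSucc, mul_comm]
    congr 1
    · simp [pw, ins_none_last]
    · simp [pw, ins_none_cs]
  · refine Finset.sum_congr rfl fun i _ => ?_
    rw [Fin.prod_univ_castSucc, ← Finset.mul_prod_erase _ _ (Finset.mem_univ i)]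
    have h1 : pw a b q (ins n (some (σ i), σ)) i.castSucc = a := by
      simp [pw, ins_some_cs, Fin.castSucc_lt_last]
    have h2 : pw a b q (ins n (some (σ i), σ)) (Fin.last n) = b := by
      simp [pw, ins_some_last, (Fin.castSucc_lt_last _).ne, Fin.le_last]
    have h3 : D (pw a b q σ i) = a * b := by
      unfold pw; split_ifs <;> assumption
    have h4 : ∏ x ∈ Finset.univ.erase i, pw a b q (ins n (some (σ i), σ)) x.castSucc =
        ∏ x ∈ Finset.univ.erase i, pw a b q σ x := by
      refine Finset.prod_congr rfl fun x hx => ?_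
      have hne : x ≠ i := Finset.ne_of_mem_erase hx
      simp [pw, ins_some_cs, hne]
    rw [h1, h2, h3, h4]; ring

/-- convolution -/
def QQ (P : ℕ → R) (n : ℕ) : R :=
  ∑ ij ∈ Finset.HasAntidiagonal.antidiagonal n, (n.choose ij.1 : R) * (P ij.1 * P ij.2)

theorem QQ_succ (D : Derivation ℤ R R) (q : R) (P : ℕ → R)
    (hP : ∀ n, P (n + 1) = q * P n + D (P n)) (n : ℕ) :
    QQ P (n + 1) = (2 * q) * QQ P n + D (QQ P n) := by
  unfold QQ
  rw [Finset.sum_antidiagonal_choose_succ_mul (fun i j => P i * P j), map_sum, Finset.mul_sum,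
    ← Finset.sum_add_distrib, ← Finset.sum_add_distrib]
  refine Finset.sum_congr rfl fun ij h => ?_
  rw [Finset.HasAntidiagonal.mem_antidiagonal] at h
  have : n.choose ij.2 = n.choose ij.1 := by
    rw [← h]; exact (Nat.choose_symm_add).symm
  rw [this, hP, hP, D.leibniz, D.leibniz, D.map_natCast]
  simp only [smul_eq_mul]
  ring

/-! ### simsun permutations -/

/-- no cycle double ascents -/
def NoCda {n : ℕ} (σ : Equiv.Perm (Fin n)) : Prop := ∀ x, ¬ (σ⁻¹ x < x ∧ x < σ x)

/-- node weight for simsun permutations -/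
def sw (v u q : R) {n : ℕ} (σ : Equiv.Perm (Fin n)) (i : Fin n) : R :=
  if σ i = i then q else if i < σ i then (if σ⁻¹ i < i then 0 else v)
    else (if σ⁻¹ i < i then 1 else u)

theorem sw_zero (v u q : R) {n : ℕ} (σ : Equiv.Perm (Fin n)) (h : ¬ NoCda σ) :
    ∏ i, sw v u q σ i = 0 := by
  unfold NoCda at h
  push Not at h
  obtain ⟨x, h1, h2⟩ := h
  exact Finset.prod_eq_zero (Finset.mem_univ x) (by unfold sw; rw [if_neg h2.ne', if_pos h2, if_pos h1])

theorem sw_none (v u q : R) {n : ℕ} (σ : Equiv.Perm (Fin n)) :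
    ∏ i, sw v u q (ins n (none, σ)) i = q * ∏ i, sw v u q σ i := by
  rw [Fin.prod_univ_castSucc, mul_comm]
  congr 1
  · simp [sw, ins_none_last]
  · simp [sw, ins_none_cs, ins_none_inv_cs]

theorem sw_some (D : Derivation ℤ R R) (v u q : R) (hv : D v = u * v) (hu : D u = v)
    (hq : D q = v) {n : ℕ} (σ : Equiv.Perm (Fin n)) (hσ : NoCda σ) (i : Fin n) :
    ∏ x, sw v u q (ins n (some (σ i), σ)) x =
      (∏ x ∈ Finset.univ.erase i, sw v u q σ x) * D (sw v u q σ i) := by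
  have hlast : sw v u q (ins n (some (σ i), σ)) (Fin.last n) = 1 := by
    simp [sw, ins_some_last, ins_some_inv_last, (Fin.castSucc_lt_last _).ne, Fin.le_last,
      Fin.castSucc_lt_last, not_lt.2]
  rw [Fin.prod_univ_castSucc, hlast, mul_one]
  have inv_lt : ∀ y, σ⁻¹ y = y ↔ σ y = y := fun y => by
    rw [Equiv.Perm.inv_eq_iff_eq, eq_comm]
  rcases lt_trichotomy i (σ i) with h | h | h
  · -- valley
    have hi := hσ i
    have hj := hσ (σ i)
    have hi' : sw v u q σ i = v := by
      unfold sw; grind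
    have hj' : sw v u q σ (σ i) = 1 := by
      have : σ⁻¹ (σ i) = i := by simp
      have h3 : σ (σ i) ≠ σ i := fun h' => h.ne' (σ.injective h')
      unfold sw; grind
    have key : ∀ x : Fin n, sw v u q (ins n (some (σ i), σ)) x.castSucc =
        sw v u q σ x * (if x = σ i then u else 1) := by
      intro x
      by_cases hx : x = i
      · subst hx
        rw [hi', if_neg h.ne]
        have : ¬ σ.symm x < x := fun h' => hi ⟨h', h⟩
        simp [sw, ins_some_cs, ins_some_inv_cs, h.ne, Fin.castSucc_lt_last,
          (Fin.castSucc_lt_last _).ne', this]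
      · by_cases hx2 : x = σ i
        · subst hx2
          have h3 : σ (σ i) ≠ σ i := fun h' => h.ne' (σ.injective h')
          have h4 : ¬ σ i < σ (σ i) := fun h' => hj ⟨by simpa using h, h'⟩
          rw [hj', if_pos rfl]
          simp [sw, ins_some_cs, ins_some_inv_cs, h.ne', h3, h4, not_lt.1 h4, Fin.le_last]
        · simp [sw, ins_some_cs, ins_some_inv_cs, hx, hx2]
    rw [Finset.prod_congr rfl (fun x _ => key x), Finset.prod_mul_distrib,
      Finset.prod_ite_eq' , if_pos (Finset.mem_univ _),
      ← Finset.mul_prod_erase _ _ (Finset.mem_univ i), hi', hv]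
    ring
  · -- fixed
    have hi' : sw v u q σ i = q := by simp [sw, ← h]
    rw [hi', hq, ← Finset.mul_prod_erase _ _ (Finset.mem_univ i), mul_comm]
    congr 1
    · refine Finset.prod_congr rfl fun x hx => ?_
      have hne : x ≠ i := Finset.ne_of_mem_erase hx
      have hne2 : x ≠ σ i := h ▸ hne
      simp [sw, ins_some_cs, ins_some_inv_cs, hne, hne2]
    · unfold sw
      rw [ins_some_cs, ins_some_inv_cs, if_pos rfl, if_pos h,
        if_neg (Fin.castSucc_lt_last _).ne', if_pos (Fin.castSucc_lt_last _),
        if_neg (not_lt.2 (Fin.le_last _))]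
  · -- drop
    have other : ∀ x : Fin n, x ≠ i → sw v u q (ins n (some (σ i), σ)) x.castSucc =
        sw v u q σ x := by
      intro x hx
      by_cases hx2 : x = σ i
      · subst hx2
        have h3 : σ (σ i) ≠ σ i := fun h' => h.ne (σ.injective h')
        simp [sw, ins_some_cs, ins_some_inv_cs, hx, h3, not_lt.2 h.le, Fin.le_last, not_lt.2]
      · simp [sw, ins_some_cs, ins_some_inv_cs, hx, hx2]
    rw [← Finset.mul_prod_erase _ _ (Finset.mem_univ i),
      Finset.prod_congr rfl (fun x hx => other x (Finset.ne_of_mem_erase hx)), mul_comm]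
    congr 1
    by_cases hp : σ.symm i < i
    · simp [sw, ins_some_cs, ins_some_inv_cs, h.ne', h.ne, Fin.castSucc_lt_last,
          (Fin.castSucc_lt_last _).ne', hp, not_lt.2 h.le]
    · simp [sw, ins_some_cs, ins_some_inv_cs, h.ne', h.ne, Fin.castSucc_lt_last,
          (Fin.castSucc_lt_last _).ne', hp, not_lt.2 h.le, hu]

/-! ### first return maps -/

theorem nextVal_step {n : ℕ} (σ : Equiv.Perm (Fin n)) (m : ℕ) (x : Fin n) :
    nextVal σ m x = if (σ x : ℕ) < m then (σ x : ℕ) else nextVal σ m (σ x) := by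
  classical
  split_ifs with h
  · have hex : ∃ t : ℕ, 0 < t ∧ (((σ ^ t) x : Fin n) : ℕ) < m := ⟨1, by simpa using h⟩
    have : Nat.find hex = 1 := by
      rw [Nat.find_eq_iff]
      exact ⟨by simpa using h, fun k hk => by omega⟩
    unfold nextVal
    rw [dif_pos hex]
    have h5 := congrArg (fun t => (((σ ^ t) x : Fin n) : ℕ)) this
    simp only [pow_one] at h5
    convert h5 using 1
  · have hsucc : ∀ t, (σ ^ t) (σ x) = (σ ^ (t + 1)) x := fun t => by
      rw [pow_succ]; rfl
    by_cases hex : ∃ t : ℕ, 0 < t ∧ (((σ ^ t) (σ x) : Fin n) : ℕ) < m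
    · have hex' : ∃ t : ℕ, 0 < t ∧ (((σ ^ t) x : Fin n) : ℕ) < m := by
        obtain ⟨t, h1, h2⟩ := hex
        exact ⟨t + 1, by omega, by rwa [← hsucc]⟩
      have hf : Nat.find hex' = Nat.find hex + 1 := by
        rw [Nat.find_eq_iff]
        refine ⟨⟨by omega, ?_⟩, ?_⟩
        · rw [← hsucc]; exact (Nat.find_spec hex).2
        · rintro k hk ⟨h1, h2⟩
          obtain ⟨k, rfl⟩ : ∃ l, k = l + 1 := ⟨k - 1, by omega⟩
          rcases Nat.eq_zero_or_pos k with rfl | hk0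
          · exact h (by simpa using h2)
          · exact Nat.find_min hex (by omega : k < Nat.find hex) ⟨hk0, by rwa [hsucc]⟩
      unfold nextVal
      rw [dif_pos hex, dif_pos hex']
      have h5 := congrArg (fun t => (((σ ^ t) x : Fin n) : ℕ)) hf
      simp only [← hsucc] at h5
      convert h5 using 1
    · have hex' : ¬ ∃ t : ℕ, 0 < t ∧ (((σ ^ t) x : Fin n) : ℕ) < m := by
        rintro ⟨t, h1, h2⟩
        obtain ⟨t, rfl⟩ : ∃ l, t = l + 1 := ⟨t - 1, by omega⟩
        rcases Nat.eq_zero_or_pos t with rfl | hk0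
        · exact h (by simpa using h2)
        · exact hex ⟨t, hk0, by rwa [hsucc]⟩
      unfold nextVal
      rw [dif_neg hex, dif_neg hex']

/-- `τ` arises from `σ` by inserting the largest letter -/
def Rel {n : ℕ} (τ : Equiv.Perm (Fin (n + 1))) (σ : Equiv.Perm (Fin n)) : Prop :=
  ∀ x : Fin n, τ x.castSucc = (σ x).castSucc ∨
    (τ x.castSucc = Fin.last n ∧ τ (Fin.last n) = (σ x).castSucc)

theorem Rel.inv {n : ℕ} {τ : Equiv.Perm (Fin (n + 1))} {σ : Equiv.Perm (Fin n)}
    (h : Rel τ σ) : Rel τ⁻¹ σ⁻¹ := by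
  intro x
  simp only [Equiv.Perm.inv_eq_iff_eq]
  have := h (σ⁻¹ x)
  rw [show σ (σ⁻¹ x) = x from σ.apply_symm_apply x] at this
  rcases this with h | ⟨h1, h2⟩
  · exact Or.inl h.symm
  · exact Or.inr ⟨h2.symm, h1.symm⟩

theorem Rel.nextVal_aux {n : ℕ} {τ : Equiv.Perm (Fin (n + 1))} {σ : Equiv.Perm (Fin n)}
    (h : Rel τ σ) (m : ℕ) (hm : m ≤ n) (t : ℕ) : ∀ x : Fin n, 0 < t → ((σ ^ t) x : ℕ) < m →
    nextVal τ m x.castSucc = nextVal σ m x := by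
  induction t with
  | zero => intro x h0; omega
  | succ t ih =>
    intro x _ hx
    have step : nextVal τ m x.castSucc =
        if (σ x : ℕ) < m then (σ x : ℕ) else nextVal τ m (σ x).castSucc := by
      rcases h x with h1 | ⟨h1, h2⟩
      · rw [nextVal_step, h1]; rfl
      · rw [nextVal_step, h1, if_neg (by simpa using hm), nextVal_step, h2]; rfl
    rw [step, nextVal_step σ m x]
    split_ifs with hlt
    · rfl
    · rw [pow_succ] at hx
      rcases Nat.eq_zero_or_pos t with rfl | ht
      · exact absurd (by simpa using hx) hlt
      · exact ih (σ x) ht hx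

theorem Rel.nextVal_eq {n : ℕ} {τ : Equiv.Perm (Fin (n + 1))} {σ : Equiv.Perm (Fin n)}
    (h : Rel τ σ) (m : ℕ) (hm : m ≤ n) (x : Fin n) (hx : (x : ℕ) < m) :
    nextVal τ m x.castSucc = nextVal σ m x :=
  h.nextVal_aux m hm (orderOf σ) x (orderOf_pos σ) (by simpa [pow_orderOf_eq_one] using hx)

theorem nextVal_top {n : ℕ} (σ : Equiv.Perm (Fin n)) (x : Fin n) : nextVal σ n x = σ x := by
  rw [nextVal_step, if_pos (σ x).2]

theorem Rel.simsun_iff {n : ℕ} {τ : Equiv.Perm (Fin (n + 1))} {σ : Equiv.Perm (Fin n)}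
    (h : Rel τ σ) : IsSimsun2 τ ↔ IsSimsun2 σ ∧ NoCda τ := by
  constructor
  · intro H
    refine ⟨fun m hm x hx => ?_, fun x => ?_⟩
    · have := H m (by omega) x.castSucc (by simpa using hx)
      rw [h.nextVal_eq m hm x hx, h.inv.nextVal_eq m hm x hx] at this
      exact this
    · have := H (n + 1) le_rfl x x.2
      rw [nextVal_top, nextVal_top] at this
      exact this
  · rintro ⟨H1, H2⟩ m hm x hx
    rcases Nat.lt_or_ge n m with hm' | hm'
    · obtain rfl : m = n + 1 := by omega
      rw [nextVal_top, nextVal_top]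
      exact H2 x
    · obtain ⟨y, rfl⟩ : ∃ y : Fin n, x = y.castSucc := ⟨⟨x, by omega⟩, rfl⟩
      have hy : (y : ℕ) < m := hx
      rw [h.nextVal_eq m hm' y hy, h.inv.nextVal_eq m hm' y hy]
      exact H1 m hm' y hy

theorem rel_none {n : ℕ} (σ : Equiv.Perm (Fin n)) : Rel (ins n (none, σ)) σ :=
  fun x => Or.inl (ins_none_cs σ x)

theorem rel_some {n : ℕ} (σ : Equiv.Perm (Fin n)) (i : Fin n) :
    Rel (ins n (some (σ i), σ)) σ := by
  intro x
  by_cases h : x = i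
  · subst h
    exact Or.inr ⟨by simp [ins_some_cs], ins_some_last _ _⟩
  · exact Or.inl (by simp [ins_some_cs, h])

theorem simsun_noCda {n : ℕ} {σ : Equiv.Perm (Fin n)} (H : IsSimsun2 σ) : NoCda σ := by
  intro x
  have := H n le_rfl x x.2
  rw [nextVal_top, nextVal_top] at this
  exact this

/-- total simsun weight -/
noncomputable def TT (v u q : R) (n : ℕ) : R :=
  ∑ σ : Equiv.Perm (Fin n), if IsSimsun2 σ then ∏ i, sw v u q σ i else 0

theorem TT_succ (D : Derivation ℤ R R) (v u q : R) (hv : D v = u * v) (hu : D u = v)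
    (hq : D q = v) (n : ℕ) : TT v u q (n + 1) = q * TT v u q n + D (TT v u q n) := by
  have red : ∀ (τ : Equiv.Perm (Fin (n + 1))) (σ : Equiv.Perm (Fin n)), Rel τ σ →
      (if IsSimsun2 τ then ∏ i, sw v u q τ i else 0) =
        if IsSimsun2 σ then ∏ i, sw v u q τ i else 0 := by
    intro τ σ h
    by_cases h1 : IsSimsun2 σ
    · by_cases h2 : NoCda τ
      · rw [if_pos (h.simsun_iff.2 ⟨h1, h2⟩), if_pos h1]
      · rw [sw_zero v u q τ h2]; simp
    · rw [if_neg h1, if_neg (fun h' => h1 (h.simsun_iff.1 h').1)]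
  unfold TT
  rw [sum_ins, map_sum, Finset.mul_sum, ← Finset.sum_add_distrib]
  refine Finset.sum_congr rfl fun σ _ => ?_
  rw [red _ σ (rel_none σ), Finset.sum_congr rfl (fun i _ => red _ σ (rel_some σ i))]
  by_cases h1 : IsSimsun2 σ
  · simp only [if_pos h1]
    rw [der_prod, sw_none, Finset.sum_congr rfl
      (fun i _ => sw_some D v u q hv hu hq σ (simsun_noCda h1) i)]
  · simp [if_neg h1]

theorem simsun_zero (σ : Equiv.Perm (Fin 0)) : IsSimsun2 σ := fun _ _ x => x.elim0

theorem QQ_eq_TT (D : Derivation ℤ R R) (a b q : R) (ha : D a = a * b) (hb : D b = a * b)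
    (hq : D q = a * b) (n : ℕ) :
    QQ (PP a b q) n = TT (2 * (a * b)) (a + b) (2 * q) n := by
  have h2 : D (2 : R) = 0 := by exact_mod_cast D.map_natCast 2
  induction n with
  | zero => simp [QQ, TT, PP, simsun_zero]
  | succ n ih =>
    rw [QQ_succ D q _ (PP_succ D a b q ha hb hq), ih, TT_succ D]
    · simp only [D.leibniz, h2, ha, hb, smul_eq_mul]; ring
    · simp only [map_add, ha, hb]; ring
    · simp only [D.leibniz, h2, hq, smul_eq_mul]; ring

theorem PP_map {S : Type*} [CommRing S] (f : R →+* S) (a b q : R) (n : ℕ) :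
    f (PP a b q n) = PP (f a) (f b) (f q) n := by
  simp only [PP, map_sum, map_prod, pw, apply_ite f]

theorem TT_map {S : Type*} [CommRing S] (f : R →+* S) (a b q : R) (n : ℕ) :
    f (TT a b q n) = TT (f a) (f b) (f q) n := by
  simp only [TT, map_sum, map_prod, sw, apply_ite f, map_zero, map_one]

theorem QQ_map {S : Type*} [CommRing S] (f : R →+* S) (P : ℕ → R) (n : ℕ) :
    f (QQ P n) = QQ (fun k => f (P k)) n := by
  simp only [QQ, map_sum, map_mul, map_natCast]

end weights

theorem main_id (x : ℝ) (n : ℕ) : QQ (PP x 1 0) n = TT (2 * x) (1 + x) 0 n := by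
  let X : Fin 3 → MvPolynomial (Fin 3) ℤ := MvPolynomial.X
  let D : Derivation ℤ (MvPolynomial (Fin 3) ℤ) (MvPolynomial (Fin 3) ℤ) :=
    MvPolynomial.mkDerivation ℤ (fun _ => X 0 * X 1)
  have hD : ∀ i, D (X i) = X 0 * X 1 := fun i => MvPolynomial.mkDerivation_X _ _ _
  let f : MvPolynomial (Fin 3) ℤ →+* ℝ := MvPolynomial.eval₂Hom (Int.castRingHom ℝ) ![x, 1, 0]
  have f0 : f (X 0) = x := by simp [f, X]
  have f1 : f (X 1) = 1 := by simp [f, X]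
  have f2 : f (X 2) = 0 := by simp [f, X]
  have h := congrArg f (QQ_eq_TT D (X 0) (X 1) (X 2) (hD 0) (hD 1) (hD 2) n)
  rw [QQ_map, TT_map] at h
  simp only [PP_map, map_mul, map_add, f0, f1, f2, map_ofNat, mul_one, mul_zero] at h
  rw [add_comm 1 x]
  exact h

theorem fixStat_eq_zero {n : ℕ} (σ : Equiv.Perm (Fin n)) :
    fixStat σ = 0 ↔ ∀ i, σ i ≠ i := by
  simp [fixStat, Finset.filter_eq_empty_iff]

theorem PP_eq (x : ℝ) (n : ℕ) : PP x 1 0 n = dpoly n x := by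
  unfold PP dpoly
  rw [Finset.sum_filter]
  refine Finset.sum_congr rfl fun σ _ => ?_
  split_ifs with h
  · rw [fixStat_eq_zero] at h
    have : ∀ i, pw x 1 0 σ i = if i < σ i then x else 1 := fun i => by simp [pw, h i]
    simp only [this, Finset.prod_ite, Finset.prod_const, excStat, one_pow, mul_one]
  · rw [fixStat_eq_zero] at h
    push Not at h
    obtain ⟨i, hi⟩ := h
    exact Finset.prod_eq_zero (Finset.mem_univ i) (by simp [pw, hi])

theorem TT_eq (x : ℝ) (n : ℕ) : TT (2 * x) (1 + x) 0 n =
    ∑ σ ∈ Finset.univ.filter fun σ : Equiv.Perm (Fin n) => IsSimsun2 σ ∧ fixStat σ = 0,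
        (2 * x) ^ excStat σ * (1 + x) ^ (n - 2 * excStat σ) := by
  unfold TT
  rw [Finset.sum_filter]
  refine Finset.sum_congr rfl fun σ _ => ?_
  by_cases hs : IsSimsun2 σ
  swap
  · simp [hs]
  by_cases h : fixStat σ = 0
  · rw [if_pos hs, if_pos ⟨hs, h⟩]
    rw [fixStat_eq_zero] at h
    have hc := simsun_noCda hs
    have hw : ∀ i, sw (2 * x) (1 + x) 0 σ i = (if i < σ i then 2 * x else 1) *
        (if ¬ (i < σ i) ∧ ¬ (σ⁻¹ i < i) then 1 + x else 1) := by
      intro i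
      have := hc i
      have := h i
      unfold sw; grind
    have hpk : (Finset.univ.filter fun i : Fin n => σ⁻¹ i < i).card = excStat σ := by
      unfold excStat
      symm
      refine Finset.card_bij (fun i _ => σ i) ?_ ?_ ?_
      · intro i hi; simpa using hi
      · intro i _ j _ hij; exact σ.injective hij
      · intro j hj; exact ⟨σ⁻¹ j, by simpa using hj, by simp⟩
    have hcard : (Finset.univ.filter fun i : Fin n => ¬ (i < σ i) ∧ ¬ (σ⁻¹ i < i)).card =
        n - 2 * excStat σ := by
      have e1 : (Finset.univ.filter fun i : Fin n => ¬ (i < σ i) ∧ ¬ (σ⁻¹ i < i)) =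
          ((Finset.univ.filter fun i : Fin n => i < σ i) ∪
            (Finset.univ.filter fun i : Fin n => σ⁻¹ i < i))ᶜ := by
        ext i; simp
      have e2 : Disjoint (Finset.univ.filter fun i : Fin n => i < σ i)
            (Finset.univ.filter fun i : Fin n => σ⁻¹ i < i) := by
        rw [Finset.disjoint_filter]
        exact fun i _ h1 h2 => hc i ⟨h2, h1⟩
      rw [e1, Finset.card_compl, Finset.card_union_of_disjoint e2, hpk, Fintype.card_fin]
      unfold excStat
      omega
    simp only [hw, Finset.prod_mul_distrib]
    rw [← hcard]
    simp only [Finset.prod_ite, Finset.prod_const, excStat, one_pow, mul_one]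
  · rw [if_pos hs, if_neg (fun h' => h h'.2)]
    rw [fixStat_eq_zero] at h
    push Not at h
    obtain ⟨i, hi⟩ := h
    exact Finset.prod_eq_zero (Finset.mem_univ i) (by simp [sw, hi])

/-- the binomial convolution of derangement polynomials is γ-positive:
`Σ_{i=0}^n C(n,i) d_i(x) d_{n-i}(x) = Σ_{σ ∈ SS_n, fix σ = 0} (2x)^exc (1+x)^(n - 2 exc)`. -/
theorem statement6 (n : ℕ) (x : ℝ) :
    ∑ i ∈ Finset.range (n + 1), (n.choose i : ℝ) * dpoly i x * dpoly (n - i) x =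
      ∑ σ ∈ Finset.univ.filter fun σ : Equiv.Perm (Fin n) => IsSimsun2 σ ∧ fixStat σ = 0,
        (2 * x) ^ excStat σ * (1 + x) ^ (n - 2 * excStat σ) := by
  rw [← TT_eq, ← main_id]
  unfold QQ
  rw [Finset.Nat.sum_antidiagonal_eq_sum_range_succ_mk]
  refine Finset.sum_congr rfl fun i _ => ?_
  simp only [PP_eq, mul_assoc]

end SucEuler
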